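/- Let f ∈ C⁰(ℝ) ∩ C²((0,∞)) be nondecreasing on ℝ, odd, and such that its restriction to (0,∞) is convex with f > 0 there; assume q₀ = lim_{u→0⁺} q(u) exists with conjugate exponent p₀. Let u ∈ C²(ℝ^N) be a bounded stable solution of −Δu = f(u) in ℝ^N (of arbitrary sign). Then u ≡ 0 if either (1) 1 ≤ N ≤ 9 and 1 < p₀, or (2) N = 10 and 1 < p₀ < +∞, or (3) N ≥ 11 and 1 < p₀ < p_c(N). -/

import Mathlib

open MeasureTheory Filter Topology
open scoped ENNReal

/-- The Laplacian of `u : ℝ^N → ℝ`. -/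
noncomputable def lap {N : ℕ} (u : EuclideanSpace ℝ (Fin N) → ℝ)
    (x : EuclideanSpace ℝ (Fin N)) : ℝ :=
  ∑ i : Fin N, iteratedFDeriv ℝ 2 u x ![EuclideanSpace.single i 1, EuclideanSpace.single i 1]

/-- `u` is a stable solution w.r.t. the linearized weight `g = f'`:
`∫ f'(u) φ² ≤ ∫ |∇φ|²` for all `φ ∈ C¹_c(ℝ^N)`. -/
def Stable {N : ℕ} (g : ℝ → ℝ) (u : EuclideanSpace ℝ (Fin N) → ℝ) : Prop :=
  ∀ φ : EuclideanSpace ℝ (Fin N) → ℝ, ContDiff ℝ 1 φ → HasCompactSupport φ →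
    ∫ x, g (u x) * (φ x) ^ 2 ≤ ∫ x, ‖gradient φ x‖ ^ 2

/-- `u` is stable outside the set `K` : the stability inequality holds for all
`φ ∈ C¹_c(ℝ^N \ K)`. -/
def StableOutside {N : ℕ} (g : ℝ → ℝ) (u : EuclideanSpace ℝ (Fin N) → ℝ)
    (K : Set (EuclideanSpace ℝ (Fin N))) : Prop :=
  ∀ φ : EuclideanSpace ℝ (Fin N) → ℝ, ContDiff ℝ 1 φ → HasCompactSupport φ →
    tsupport φ ⊆ Kᶜ →
    ∫ x, g (u x) * (φ x) ^ 2 ≤ ∫ x, ‖gradient φ x‖ ^ 2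

/-- The quantity `q(u) = f'(u)²/(f(u) f''(u)) ∈ [0,∞]`, with the convention
`q(u) = +∞` when `f(u) f''(u) = 0`. -/
noncomputable def qfun (f : ℝ → ℝ) (t : ℝ) : ℝ≥0∞ :=
  if f t * deriv (deriv f) t = 0 then ⊤
  else ENNReal.ofReal ((deriv f t) ^ 2 / (f t * deriv (deriv f) t))

/-- The Joseph–Lundgren exponent `p_c(N)` (for `N ≥ 11`). -/
noncomputable def pc (N : ℕ) : ℝ :=
  (((N : ℝ) - 2) ^ 2 - 4 * N + 8 * Real.sqrt ((N : ℝ) - 1)) / (((N : ℝ) - 2) * ((N : ℝ) - 10))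

/-- Green's formula `∫ (Δu) v = -∫ ∇u·∇v` for a compactly supported test function `v`. -/
theorem integral_lap_mul {N : ℕ} {u v : EuclideanSpace ℝ (Fin N) → ℝ}
    (hu : ContDiff ℝ 2 u) (hv : ContDiff ℝ 1 v) (hvc : HasCompactSupport v) :
    ∫ x, lap u x * v x = -∫ x, inner ℝ (gradient u x) (gradient v x) := by
  have hdu : ContDiff ℝ 1 (fderiv ℝ u) := hu.fderiv_right (by norm_num)
  have hdv : Continuous (fderiv ℝ v) := hv.continuous_fderiv (by norm_num)
  have hvc' : HasCompactSupport (fderiv ℝ v) := hvc.fderiv (𝕜 := ℝ)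
  set e : Fin N → EuclideanSpace ℝ (Fin N) := fun i => EuclideanSpace.single i 1 with he
  have hd1 : ∀ i, ContDiff ℝ 1 (fun x => fderiv ℝ u x (e i)) := fun i =>
    hdu.clm_apply contDiff_const
  have hint1 : ∀ i, Integrable (fun x => fderiv ℝ (fun y => fderiv ℝ u y (e i)) x (e i) * v x) := by
    intro i
    refine Continuous.integrable_of_hasCompactSupport ?_ hvc.mul_left
    exact (((hd1 i).continuous_fderiv (by norm_num)).clm_apply continuous_const).mul hv.continuous
  have hint2 : ∀ i, Integrable (fun x => fderiv ℝ u x (e i) * fderiv ℝ v x (e i)) := by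
    intro i
    refine Continuous.integrable_of_hasCompactSupport ?_ ?_
    · exact (hd1 i).continuous.mul (hdv.clm_apply continuous_const)
    · refine HasCompactSupport.mul_left ?_
      exact hvc'.comp_left (g := fun L => L (e i)) (by simp)
  have hint3 : ∀ i, Integrable (fun x => fderiv ℝ u x (e i) * v x) := fun i =>
    ((hd1 i).continuous.mul hv.continuous).integrable_of_hasCompactSupport hvc.mul_left
  have hlap : ∀ x, lap u x * v x
      = ∑ i, fderiv ℝ (fun y => fderiv ℝ u y (e i)) x (e i) * v x := by
    intro x
    rw [lap, Finset.sum_mul]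
    refine Finset.sum_congr rfl fun i _ => ?_
    rw [iteratedFDeriv_two_apply, fderiv_clm_apply (hdu.differentiable (by norm_num) x)
      (differentiableAt_const _)]
    simp [he]
  have hinner : ∀ x, inner ℝ (gradient u x) (gradient v x)
      = ∑ i, fderiv ℝ u x (e i) * fderiv ℝ v x (e i) := by
    intro x
    rw [← (EuclideanSpace.basisFun (Fin N) ℝ).sum_inner_mul_inner]
    refine Finset.sum_congr rfl fun i _ => ?_
    rw [real_inner_comm (gradient v x), ← toDual_gradient, ← toDual_gradient,
      InnerProductSpace.toDual_apply_apply, InnerProductSpace.toDual_apply_apply]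
    simp [he]
  simp_rw [hlap, hinner]
  rw [integral_finsetSum _ fun i _ => hint1 i, integral_finsetSum _ fun i _ => hint2 i,
    ← Finset.sum_neg_distrib]
  refine Finset.sum_congr rfl fun i _ => ?_
  rw [integral_mul_fderiv_eq_neg_fderiv_mul_of_integrable (hint1 i) (hint2 i) (hint3 i)
    (fun x _ => (hd1 i).differentiable (by norm_num) x)
    (fun x _ => hv.differentiable (by norm_num) x), neg_neg]

/-- The pointwise inequality behind the Caccioppoli-type estimate. -/
theorem caccioppoli_pointwise {E : Type*} [NormedAddCommGroup E] [InnerProductSpace ℝ E]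
    {κ θ a d s F F' : ℝ} (hκ : 0 < κ) (h1 : F * s ≤ θ * (F' * a ^ 2)) (h2 : |s| ≤ |a * d|)
    (e : ℝ) (g k : E) :
    (1 - (1 + κ) * θ) * (F' * a ^ 2 * e ^ 2) - (1 + (κ + 2) ^ 2 / κ) * (a ^ 2 * ‖k‖ ^ 2)
      ≤ (F' * (a * e) ^ 2 - ‖a • k + (e * d) • g‖ ^ 2)
        + (1 + κ) * (inner ℝ g ((2 * s * e) • k + (e ^ 2 * d ^ 2) • g) - F * (s * e ^ 2)) := by
  rw [norm_add_sq_real, inner_add_right, real_inner_smul_left, real_inner_smul_right,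
    real_inner_smul_right, real_inner_smul_right, real_inner_self_eq_norm_sq, norm_smul,
    norm_smul, real_inner_comm g k]
  simp only [mul_pow, Real.norm_eq_abs, sq_abs]
  have hp := abs_real_inner_le_norm g k
  generalize inner ℝ g k = p at *
  generalize ‖g‖ = A at *
  generalize ‖k‖ = B at *
  have h3 : |(1 + κ) * s - a * d| ≤ (κ + 2) * |a * d| := by
    have := abs_sub ((1 + κ) * s) (a * d)
    rw [abs_mul, abs_of_pos (by linarith : 0 < 1 + κ)] at this
    nlinarith [abs_nonneg (a * d)]
  have h4 : |((1 + κ) * s - a * d) * e * p| ≤ (κ + 2) * |a * d| * |e| * (A * B) := by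
    rw [abs_mul, abs_mul]
    gcongr
  have h5 : 2 * ((κ + 2) * |a * d| * |e| * (A * B))
      ≤ κ * (d ^ 2 * e ^ 2 * A ^ 2) + (κ + 2) ^ 2 / κ * (a ^ 2 * B ^ 2) := by
    have h6 : 0 ≤ κ * (|d| * |e| * A - (κ + 2) / κ * (|a| * B)) ^ 2 := by positivity
    have h7 : κ * (|d| * |e| * A - (κ + 2) / κ * (|a| * B)) ^ 2
        = κ * (|d| ^ 2 * |e| ^ 2 * A ^ 2) - 2 * ((κ + 2) * (|a| * |d|) * |e| * (A * B))
          + (κ + 2) ^ 2 / κ * (|a| ^ 2 * B ^ 2) := by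
      field_simp
      ring
    rw [h7, sq_abs, sq_abs, sq_abs, ← abs_mul] at h6
    linarith
  have h8 := neg_abs_le (((1 + κ) * s - a * d) * e * p)
  have h9 : (1 + κ) * (F * s) * e ^ 2
      ≤ (1 + κ) * (θ * (F' * a ^ 2)) * e ^ 2 := by gcongr
  nlinarith

/-- The weighted Caccioppoli-type estimate obtained by testing stability with `φ(u) η` and the
equation with `ψ(u) η²`, where `ψ' = φ'²`. -/
theorem Stable.exists_integral_le {N : ℕ} {f : ℝ → ℝ} (hcont : Continuous f)
    (hcont' : Continuous (deriv f)) {u : EuclideanSpace ℝ (Fin N) → ℝ} (hu : ContDiff ℝ 2 u)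
    (hsol : ∀ x, -lap u x = f (u x)) (hstab : Stable (deriv f) u) {φ φ' ψ : ℝ → ℝ}
    (hφ' : Continuous φ') (hφ : ∀ t, HasDerivAt φ (φ' t) t)
    (hψ : ∀ t, HasDerivAt ψ (φ' t ^ 2) t) {θ : ℝ} (hθ : θ < 1)
    (hfψ : ∀ x, f (u x) * ψ (u x) ≤ θ * (deriv f (u x) * φ (u x) ^ 2))
    (hψφ : ∀ x, |ψ (u x)| ≤ |φ (u x) * φ' (u x)|) :
    ∃ c > 0, ∃ C > 0, ∀ η : EuclideanSpace ℝ (Fin N) → ℝ, ContDiff ℝ 1 η → HasCompactSupport η →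
      c * ∫ x, deriv f (u x) * φ (u x) ^ 2 * η x ^ 2
        ≤ C * ∫ x, φ (u x) ^ 2 * ‖gradient η x‖ ^ 2 := by
  obtain ⟨κ, hκ, hκθ⟩ : ∃ κ > 0, (1 + κ) * θ < 1 := by
    refine ⟨(1 - θ) / 2, by linarith, by nlinarith⟩
  refine ⟨1 - (1 + κ) * θ, by linarith, 1 + (κ + 2) ^ 2 / κ, by positivity, ?_⟩
  intro η hη hηc
  have hφ1 : ContDiff ℝ 1 φ := by
    rw [contDiff_one_iff_deriv]
    refine ⟨fun t => (hφ t).differentiableAt, ?_⟩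
    rwa [show deriv φ = φ' from funext fun t => (hφ t).deriv]
  have hψ1 : ContDiff ℝ 1 ψ := by
    rw [contDiff_one_iff_deriv]
    refine ⟨fun t => (hψ t).differentiableAt, ?_⟩
    rw [show deriv ψ = fun t => φ' t ^ 2 from funext fun t => (hψ t).deriv]
    exact hφ'.pow 2
  have hu1 : ContDiff ℝ 1 u := hu.of_le (by norm_num)
  have hηd : ∀ x, DifferentiableAt ℝ η x := hη.differentiable (by norm_num)
  have hud : ∀ x, DifferentiableAt ℝ u x := hu1.differentiable (by norm_num)
  have hgrad : ∀ {w : EuclideanSpace ℝ (Fin N) → ℝ}, ContDiff ℝ 1 w → Continuous (gradient w) := by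
    intro w hw
    exact (InnerProductSpace.toDual ℝ (EuclideanSpace ℝ (Fin N))).symm.continuous.comp
      (hw.continuous_fderiv (by norm_num))
  have hgu := hgrad hu1
  have hgη := hgrad hη
  have hgηc : HasCompactSupport (gradient η) :=
    (hηc.fderiv (𝕜 := ℝ)).comp_left (map_zero _)
  have hg1 : ∀ x, gradient (fun y => φ (u y) * η y) x
      = φ (u x) • gradient η x + (η x * φ' (u x)) • gradient u x := by
    intro x
    have h : HasFDerivAt (fun y => φ (u y) * η y) _ x :=
      ((hφ (u x)).comp_hasFDerivAt x (hud x).hasFDerivAt).mul (hηd x).hasFDerivAt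
    rw [gradient, h.fderiv]
    simp [gradient, smul_smul]
  have hg2 : ∀ x, gradient (fun y => ψ (u y) * η y ^ 2) x
      = (2 * ψ (u x) * η x) • gradient η x + (η x ^ 2 * φ' (u x) ^ 2) • gradient u x := by
    intro x
    have h : HasFDerivAt (fun y => ψ (u y) * η y ^ 2) _ x :=
      ((hψ (u x)).comp_hasFDerivAt x (hud x).hasFDerivAt).mul ((hηd x).hasFDerivAt.pow 2)
    rw [gradient, h.fderiv]
    simp only [Function.comp_apply, map_add, map_smulₛₗ, gradient, map_nsmul, Nat.reduceSub,
      pow_one, conj_trivial]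
    module
  have hS := hstab (fun y => φ (u y) * η y) ((hφ1.comp hu1).mul hη) hηc.mul_left
  have hη2c : HasCompactSupport (fun y => η y ^ 2) :=
    hηc.comp_left (g := fun s : ℝ => s ^ 2) (by norm_num)
  have hE := integral_lap_mul (v := fun y => ψ (u y) * η y ^ 2) hu
    ((hψ1.comp hu1).mul (hη.pow 2)) hη2c.mul_left
  simp_rw [hg1] at hS
  simp_rw [hg2] at hE
  have hE' : ∫ x, f (u x) * (ψ (u x) * η x ^ 2) = ∫ x, inner ℝ (gradient u x)
      ((2 * ψ (u x) * η x) • gradient η x + (η x ^ 2 * φ' (u x) ^ 2) • gradient u x) := by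
    rw [← neg_inj, ← hE, ← integral_neg]
    refine integral_congr_ae (Eventually.of_forall fun x => ?_)
    simp only [← hsol x]
    ring
  have cu := hu.continuous
  have cη := hη.continuous
  have cφ := hφ1.continuous
  have cψ := hψ1.continuous
  have i1 : Integrable (fun x => deriv f (u x) * (φ (u x) * η x) ^ 2) := by
    refine Continuous.integrable_of_hasCompactSupport (by fun_prop) ?_
    simp_rw [mul_pow]
    exact hη2c.mul_left.mul_left
  have i2 : Integrable (fun x =>
      ‖φ (u x) • gradient η x + (η x * φ' (u x)) • gradient u x‖ ^ 2) := by
    refine Continuous.integrable_of_hasCompactSupport (by fun_prop) ?_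
    refine HasCompactSupport.comp_left (g := fun v : EuclideanSpace ℝ (Fin N) => ‖v‖ ^ 2) ?_
      (by norm_num)
    exact (hgηc.smul_left (f := fun x => φ (u x))).add
      ((hηc.mul_right (f' := fun x => φ' (u x))).smul_right (f' := gradient u))
  have i3 : Integrable (fun x => f (u x) * (ψ (u x) * η x ^ 2)) :=
    Continuous.integrable_of_hasCompactSupport (by fun_prop) hη2c.mul_left.mul_left
  have i4 : Integrable (fun x => inner ℝ (gradient u x)
      ((2 * ψ (u x) * η x) • gradient η x + (η x ^ 2 * φ' (u x) ^ 2) • gradient u x)) := by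
    refine Continuous.integrable_of_hasCompactSupport (by fun_prop) ?_
    have : HasCompactSupport (fun x => (2 * ψ (u x) * η x) • gradient η x
        + (η x ^ 2 * φ' (u x) ^ 2) • gradient u x) :=
      (hgηc.smul_left (f := fun x => 2 * ψ (u x) * η x)).add
        ((hη2c.mul_right (f' := fun x => φ' (u x) ^ 2)).smul_right (f' := gradient u))
    refine this.mono fun x hx => ?_
    contrapose! hx
    simp only [Function.mem_support, not_not] at hx ⊢
    rw [hx, inner_zero_right]
  have i5 : Integrable (fun x => deriv f (u x) * φ (u x) ^ 2 * η x ^ 2) :=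
    Continuous.integrable_of_hasCompactSupport (by fun_prop) hη2c.mul_left
  have i6 : Integrable (fun x => φ (u x) ^ 2 * ‖gradient η x‖ ^ 2) := by
    refine Continuous.integrable_of_hasCompactSupport (by fun_prop) ?_
    exact (hgηc.comp_left (g := fun v => ‖v‖ ^ 2) (by norm_num)).mul_left
  have key : ∫ x, ((1 - (1 + κ) * θ) * (deriv f (u x) * φ (u x) ^ 2 * η x ^ 2)
      - (1 + (κ + 2) ^ 2 / κ) * (φ (u x) ^ 2 * ‖gradient η x‖ ^ 2))
      ≤ ∫ x, ((deriv f (u x) * (φ (u x) * η x) ^ 2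
        - ‖φ (u x) • gradient η x + (η x * φ' (u x)) • gradient u x‖ ^ 2)
        + (1 + κ) * (inner ℝ (gradient u x)
      ((2 * ψ (u x) * η x) • gradient η x + (η x ^ 2 * φ' (u x) ^ 2) • gradient u x)
        - f (u x) * (ψ (u x) * η x ^ 2))) := by
    refine integral_mono ((i5.const_mul _).sub (i6.const_mul _))
      ((i1.sub i2).add ((i4.sub i3).const_mul _)) fun x => ?_
    simp only
    exact caccioppoli_pointwise hκ (hfψ x) (hψφ x) _ _ _
  have e1 := integral_sub (i5.const_mul (1 - (1 + κ) * θ)) (i6.const_mul (1 + (κ + 2) ^ 2 / κ))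
  have e2 := integral_add (i1.sub i2) ((i4.sub i3).const_mul (1 + κ))
  have e3 := integral_sub i1 i2
  have e4 := integral_sub i4 i3
  rw [e1, integral_const_mul, integral_const_mul] at key
  simp only [Pi.sub_apply] at e2
  rw [e2, integral_const_mul, e3, e4, hE'] at key
  linarith

/-- Cut-off functions at scale `1 / r` whose gradient is `O(r)`. -/
theorem exists_cutoff_family (N : ℕ) : ∃ L : ℝ, ∃ T : ℝ → EuclideanSpace ℝ (Fin N) → ℝ, 0 ≤ L ∧
    ∀ r > 0, ContDiff ℝ 1 (T r) ∧ HasCompactSupport (T r) ∧ (∀ x, T r x ∈ Set.Icc (0 : ℝ) 1) ∧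
      (∀ x, r * ‖x‖ ≤ 1 → T r x = 1) ∧ (∀ x, 2 ≤ r * ‖x‖ → T r x = 0) ∧
      ∀ x, ‖fderiv ℝ (T r) x‖ ≤ L * r := by
  obtain ⟨ρ, hρ, hρc, hρ0, hρ1, hρ2⟩ : ∃ ρ : EuclideanSpace ℝ (Fin N) → ℝ, ContDiff ℝ 1 ρ ∧
      HasCompactSupport ρ ∧ (∀ x, ρ x ∈ Set.Icc (0 : ℝ) 1) ∧ (∀ x, ‖x‖ ≤ 1 → ρ x = 1) ∧
      (∀ x, 2 ≤ ‖x‖ → ρ x = 0) := by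
    let ρ : ContDiffBump (0 : EuclideanSpace ℝ (Fin N)) := ⟨1, 2, one_pos, by norm_num⟩
    refine ⟨ρ, ρ.contDiff, ρ.hasCompactSupport, fun x => ⟨ρ.nonneg, ρ.le_one⟩, fun x hx => ?_,
      fun x hx => ?_⟩
    · exact ρ.one_of_mem_closedBall (by simpa using hx)
    · exact ρ.zero_of_le_dist (by simpa using hx)
  obtain ⟨L, hL⟩ := (hρ.continuous_fderiv (by norm_num)).bounded_above_of_compact_support
    (hρc.fderiv (𝕜 := ℝ))
  have hL0 : 0 ≤ L := (norm_nonneg _).trans (hL 0)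
  refine ⟨L, fun r x => ρ (r • x), hL0, fun r hr => ⟨hρ.comp (contDiff_const_smul r),
    hρc.comp_smul hr.ne', fun x => hρ0 _, fun x hx => hρ1 _ ?_, fun x hx => hρ2 _ ?_, fun x => ?_⟩⟩
  · rwa [norm_smul, Real.norm_of_nonneg hr.le]
  · rwa [norm_smul, Real.norm_of_nonneg hr.le]
  · have h1 : HasFDerivAt (fun y => ρ (r • y)) _ x :=
      ((hρ.differentiable (by norm_num) (r • x)).hasFDerivAt).comp x
        ((hasFDerivAt_id x).const_smul r)
    rw [h1.fderiv]
    refine (ContinuousLinearMap.opNorm_comp_le _ _).trans ?_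
    refine mul_le_mul (hL _) ?_ (norm_nonneg _) hL0
    rw [norm_smul, Real.norm_of_nonneg hr.le]
    exact mul_le_of_le_one_right hr.le ContinuousLinearMap.norm_id_le

theorem norm_gradient_pow_le {E : Type*} [NormedAddCommGroup E] [InnerProductSpace ℝ E]
    [CompleteSpace E] {T : E → ℝ} (hT : Differentiable ℝ T) (hT0 : ∀ x, 0 ≤ T x) {L : ℝ} {x : E}
    (hL : ‖fderiv ℝ T x‖ ≤ L) (m : ℕ) :
    ‖gradient (fun y => T y ^ (m + 1)) x‖ ≤ (m + 1) * L * T x ^ m := by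
  have h2 := (hT x).hasFDerivAt.pow (m + 1)
  have h4 : ‖(m + 1) • T x ^ (m + 1 - 1)‖ = (m + 1) * T x ^ m := by
    rw [nsmul_eq_mul, Real.norm_of_nonneg
      (mul_nonneg (Nat.cast_nonneg _) (pow_nonneg (hT0 _) _))]
    simp
  rw [gradient, LinearIsometryEquiv.norm_map, h2.fderiv, norm_smul, h4]
  calc _ ≤ (m + 1) * T x ^ m * L :=
        mul_le_mul_of_nonneg_left hL (mul_nonneg (by positivity) (pow_nonneg (hT0 _) _))
    _ = _ := by ring

theorem absorb_or_decay {W P T K D c β r : ℝ} {m : ℕ} (hW : 0 ≤ W) (hP : 0 ≤ P) (hT0 : 0 ≤ T)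
    (hT1 : T ≤ 1) (hK : 0 ≤ K) (hD : 0 < D) (hc : 0 < c) (hβ : 0 < β) (hmβ : β ≤ m) (hr : 0 < r)
    (hPW : P ≤ K * W ^ β) :
    P * (T ^ m) ^ 2 * (D * r ^ 2) ≤ c / 2 * (W * P * (T ^ (m + 1)) ^ 2)
      + D * K * (2 * D / c) ^ β * (r ^ 2) ^ (1 + β) := by
  rcases le_or_gt (D * r ^ 2) (c / 2 * (W * T ^ 2)) with h | h
  · have h1 : P * (T ^ m) ^ 2 * (D * r ^ 2) ≤ P * (T ^ m) ^ 2 * (c / 2 * (W * T ^ 2)) := by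
      gcongr
    have h2 : 0 ≤ D * K * (2 * D / c) ^ β * (r ^ 2) ^ (1 + β) := by positivity
    calc _ ≤ _ := h1
      _ = c / 2 * (W * P * (T ^ (m + 1)) ^ 2) := by ring
      _ ≤ _ := by linarith
  · have h1 : W * T ^ 2 ≤ 2 * D / c * r ^ 2 := by
      rw [div_mul_eq_mul_div, le_div_iff₀ hc]
      linarith
    have h2 : (W * T ^ 2) ^ β ≤ (2 * D / c) ^ β * (r ^ 2) ^ β := by
      rw [← Real.mul_rpow (by positivity) (by positivity)]
      exact Real.rpow_le_rpow (by positivity) h1 hβ.le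
    have h3 : (T ^ m) ^ 2 ≤ (T ^ 2) ^ β := by
      rw [← pow_mul, mul_comm, pow_mul, ← Real.rpow_natCast (T ^ 2) m]
      exact Real.rpow_le_rpow_of_exponent_ge' (by positivity) (pow_le_one₀ hT0 hT1) hβ.le hmβ
    have h4 : P * (T ^ m) ^ 2 ≤ K * ((2 * D / c) ^ β * (r ^ 2) ^ β) := by
      calc P * (T ^ m) ^ 2 ≤ (K * W ^ β) * (T ^ 2) ^ β := by gcongr
        _ = K * (W * T ^ 2) ^ β := by rw [Real.mul_rpow hW (by positivity)]; ring
        _ ≤ _ := by gcongr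
    have h5 : 0 ≤ c / 2 * (W * P * (T ^ (m + 1)) ^ 2) := by positivity
    calc P * (T ^ m) ^ 2 * (D * r ^ 2)
        ≤ K * ((2 * D / c) ^ β * (r ^ 2) ^ β) * (D * r ^ 2) := by gcongr
      _ = D * K * (2 * D / c) ^ β * (r ^ 2) ^ (1 + β) := by
        rw [Real.rpow_add (by positivity), Real.rpow_one]
        ring
      _ ≤ _ := by linarith

/-- If `w p` satisfies a Caccioppoli-type inequality with `p ≤ K w ^ β` and the dimension is
below `2 + 2β`, then `w p` vanishes identically. -/
theorem mul_eq_zero_of_caccioppoli {N : ℕ} {w p : EuclideanSpace ℝ (Fin N) → ℝ}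
    (hw : Continuous w) (hp : Continuous p) (hw0 : ∀ x, 0 ≤ w x) (hp0 : ∀ x, 0 ≤ p x)
    {K β : ℝ} (hβ : 0 < β) (hK : 0 ≤ K) (hpw : ∀ x, p x ≤ K * w x ^ β) (hN : N < 2 + 2 * β)
    {c C : ℝ} (hc : 0 < c) (hC : 0 < C)
    (hcac : ∀ η : EuclideanSpace ℝ (Fin N) → ℝ, ContDiff ℝ 1 η → HasCompactSupport η →
      c * ∫ x, w x * p x * η x ^ 2 ≤ C * ∫ x, p x * ‖gradient η x‖ ^ 2)
    (x₀ : EuclideanSpace ℝ (Fin N)) : w x₀ * p x₀ = 0 := by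
  obtain ⟨L, T, hL, hTr⟩ := exists_cutoff_family N
  obtain ⟨m, hm, hmβ⟩ : ∃ m : ℕ, 1 ≤ m ∧ β ≤ m := by
    refine ⟨⌈β⌉₊ + 1, by omega, ?_⟩
    push_cast
    linarith [Nat.le_ceil β]
  have hη : ∀ r > 0, ContDiff ℝ 1 (fun x => T r x ^ (m + 1)) := fun r hr => (hTr r hr).1.pow _
  have hηc : ∀ r > 0, HasCompactSupport (fun x => T r x ^ (m + 1)) := fun r hr =>
    (hTr r hr).2.1.comp_left (g := fun s : ℝ => s ^ (m + 1)) (by simp)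
  set D : ℝ := C * ((m + 1) * L) ^ 2 + 1 with hD
  have hDpos : 0 < D := by positivity
  set C₃ : ℝ := D * K * (2 * D / c) ^ β with hC₃
  have hpt : ∀ r > 0, ∀ x, C * (p x * ‖gradient (fun x => T r x ^ (m + 1)) x‖ ^ 2)
      ≤ c / 2 * (w x * p x * (T r x ^ (m + 1)) ^ 2)
        + (Metric.closedBall 0 (2 / r)).indicator (fun _ => C₃ * (r ^ 2) ^ (1 + β)) x := by
    intro r hr x
    obtain ⟨hT1, -, hT3, -, hT5, hT6⟩ := hTr r hr
    have hg := norm_gradient_pow_le (hT1.differentiable (by norm_num)) (fun x => (hT3 x).1)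
      (hT6 x) m
    have hg2 : C * (p x * ‖gradient (fun x => T r x ^ (m + 1)) x‖ ^ 2)
        ≤ p x * (T r x ^ m) ^ 2 * (D * r ^ 2) := by
      have hp := hp0 x
      calc C * (p x * ‖gradient (fun x => T r x ^ (m + 1)) x‖ ^ 2)
          ≤ C * (p x * ((m + 1) * (L * r) * T r x ^ m) ^ 2) := by gcongr
        _ = p x * (T r x ^ m) ^ 2 * ((D - 1) * r ^ 2) := by rw [hD]; ring
        _ ≤ _ := by
            gcongr
            linarith
    refine hg2.trans ?_
    by_cases hx : x ∈ Metric.closedBall (0 : EuclideanSpace ℝ (Fin N)) (2 / r)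
    · rw [Set.indicator_of_mem hx]
      exact absorb_or_decay (hw0 x) (hp0 x) (hT3 x).1 (hT3 x).2 hK hDpos hc hβ hmβ hr (hpw x)
    · rw [Set.indicator_of_notMem hx]
      rw [Metric.mem_closedBall, dist_zero_right, not_le, div_lt_iff₀ hr] at hx
      rw [hT5 x (by linarith), zero_pow (by omega), zero_pow (by omega)]
      simp
  have hgη : ∀ r > 0, Continuous (gradient (fun x => T r x ^ (m + 1))) := fun r hr =>
    (InnerProductSpace.toDual ℝ (EuclideanSpace ℝ (Fin N))).symm.continuous.comp
      ((hη r hr).continuous_fderiv (by norm_num))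
  have i1 : ∀ r > 0, Integrable (fun x => w x * p x * (T r x ^ (m + 1)) ^ 2) := by
    intro r hr
    have := (hη r hr).continuous
    refine Continuous.integrable_of_hasCompactSupport (by fun_prop) ?_
    exact ((hηc r hr).comp_left (g := fun s : ℝ => s ^ 2) (by norm_num)).mul_left
  have i2 : ∀ r > 0, Integrable (fun x => p x * ‖gradient (fun x => T r x ^ (m + 1)) x‖ ^ 2) := by
    intro r hr
    have := hgη r hr
    refine Continuous.integrable_of_hasCompactSupport (by fun_prop) ?_
    have h : HasCompactSupport (gradient (fun x => T r x ^ (m + 1))) :=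
      ((hηc r hr).fderiv (𝕜 := ℝ)).comp_left (map_zero _)
    exact (h.comp_left (g := fun v => ‖v‖ ^ 2) (by norm_num)).mul_left
  set V : ℝ := (volume : Measure (EuclideanSpace ℝ (Fin N))).real (Metric.ball 0 1) with hV
  have hbound : ∀ r > 0, c / 2 * ∫ x, w x * p x * (T r x ^ (m + 1)) ^ 2
      ≤ (2 / r) ^ N * V * (C₃ * (r ^ 2) ^ (1 + β)) := by
    intro r hr
    have i3 : Integrable ((Metric.closedBall (0 : EuclideanSpace ℝ (Fin N)) (2 / r)).indicator
        (fun _ => C₃ * (r ^ 2) ^ (1 + β))) :=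
      (integrableOn_const measure_closedBall_lt_top.ne).integrable_indicator
        measurableSet_closedBall
    have h1 := integral_mono ((i2 r hr).const_mul C)
      (((i1 r hr).const_mul (c / 2)).add i3) (hpt r hr)
    simp only [Pi.add_apply] at h1
    rw [integral_const_mul, integral_add ((i1 r hr).const_mul (c / 2)) i3,
      integral_const_mul, integral_indicator_const _ measurableSet_closedBall, smul_eq_mul,
      Measure.addHaar_real_closedBall _ _ (by positivity), finrank_euclideanSpace_fin] at h1
    have h2 := hcac _ (hη r hr) (hηc r hr)
    linarith
  by_contra hne
  set r₀ : ℝ := (‖x₀‖ + 1)⁻¹ with hr₀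
  have hr₀pos : 0 < r₀ := by positivity
  have hx₀ : T r₀ x₀ = 1 := by
    refine (hTr r₀ hr₀pos).2.2.2.1 x₀ ?_
    rw [hr₀, inv_mul_le_one₀ (by positivity)]
    linarith
  have hpos : 0 < ∫ x, w x * p x * (T r₀ x ^ (m + 1)) ^ 2 := by
    refine Continuous.integral_pos_of_hasCompactSupport_nonneg_nonzero (x := x₀)
      ((hw.mul hp).mul ((hη r₀ hr₀pos).continuous.pow 2)) ?_ ?_ ?_
    · exact ((hηc r₀ hr₀pos).comp_left (g := fun s : ℝ => s ^ 2) (by norm_num)).mul_left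
    · exact fun x => mul_nonneg (mul_nonneg (hw0 x) (hp0 x)) (sq_nonneg _)
    · simpa [hx₀] using hne
  have hmono : ∀ r > 0, r ≤ r₀ / 2 →
      ∫ x, w x * p x * (T r₀ x ^ (m + 1)) ^ 2 ≤ ∫ x, w x * p x * (T r x ^ (m + 1)) ^ 2 := by
    intro r hr hrr
    refine integral_mono (i1 r₀ hr₀pos) (i1 r hr) fun x => ?_
    refine mul_le_mul_of_nonneg_left ?_ (mul_nonneg (hw0 x) (hp0 x))
    obtain ⟨-, -, hT3, -, hT5, -⟩ := hTr r₀ hr₀pos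
    rcases le_total 2 (r₀ * ‖x‖) with hx | hx
    · rw [hT5 x hx, zero_pow (by omega), zero_pow two_ne_zero]
      positivity
    · rw [(hTr r hr).2.2.2.1 x (by nlinarith [norm_nonneg x]), one_pow, one_pow]
      exact pow_le_one₀ (pow_nonneg (hT3 x).1 _) (pow_le_one₀ (hT3 x).1 (hT3 x).2)
  have hlim : Tendsto (fun R : ℝ => (2 / R⁻¹) ^ N * V * (C₃ * ((R⁻¹) ^ 2) ^ (1 + β))) atTop
      (𝓝 0) := by
    have h1 : Tendsto (fun R : ℝ => 2 ^ N * V * C₃ * R ^ (-(2 + 2 * β - N))) atTop (𝓝 0) := by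
      simpa using (tendsto_rpow_neg_atTop (by linarith : 0 < 2 + 2 * β - N)).const_mul
        (2 ^ N * V * C₃)
    refine h1.congr' ?_
    filter_upwards [eventually_gt_atTop 0] with R hR
    have h2 : ((R⁻¹) ^ 2) ^ (1 + β) = R ^ (-(2 + 2 * β)) := by
      rw [inv_pow, Real.inv_rpow (by positivity), ← Real.rpow_natCast R 2,
        ← Real.rpow_mul hR.le, ← Real.rpow_neg hR.le]
      congr 1
      push_cast
      ring
    rw [h2, div_inv_eq_mul, mul_pow, ← Real.rpow_natCast R N,
      show -(2 + 2 * β - N) = (N : ℝ) + -(2 + 2 * β) by ring, Real.rpow_add hR]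
    ring
  have hle : c / 2 * ∫ x, w x * p x * (T r₀ x ^ (m + 1)) ^ 2 ≤ 0 := by
    refine ge_of_tendsto hlim ?_
    filter_upwards [eventually_ge_atTop (2 / r₀)] with R hR
    have hRpos : 0 < R := lt_of_lt_of_le (by positivity) hR
    have h1 : R⁻¹ ≤ r₀ / 2 := by
      rw [← inv_div]
      exact inv_anti₀ (by positivity) hR
    have h2 := hmono R⁻¹ (by positivity) h1
    have h3 := hbound R⁻¹ (by positivity)
    nlinarith
  nlinarith

/-- In the range of exponents of the Liouville theorem, `q₀` is a real number `Q ≥ 1` and the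
dimension is below `2 + 4Q + 4√Q`. -/
theorem exists_toReal_of_dim {N : ℕ} {q₀ p₀ : ℝ≥0∞} (hpq : 1 / p₀ + 1 / q₀ = 1)
    (hdim : (N ≤ 9 ∧ 1 < p₀) ∨ (N = 10 ∧ 1 < p₀ ∧ p₀ < ⊤) ∨
      (11 ≤ N ∧ 1 < p₀ ∧ p₀ < ENNReal.ofReal (pc N))) :
    ∃ Q : ℝ, 1 ≤ Q ∧ q₀ = ENNReal.ofReal Q ∧ (N : ℝ) < 2 + 4 * Q + 4 * √Q := by
  have hp1 : 1 < p₀ := by rcases hdim with h | h | h; exacts [h.2, h.2.1, h.2.1]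
  have hqtop : q₀ ≠ ⊤ := by
    rintro rfl
    simp only [one_div, ENNReal.inv_top, add_zero, ENNReal.inv_eq_one] at hpq
    exact hp1.ne' hpq
  have hq1 : 1 ≤ q₀ := by
    have : 1 / q₀ ≤ 1 := le_add_self.trans hpq.le
    simpa using this
  set Q := q₀.toReal with hQ
  have hQ1 : 1 ≤ Q := by
    rw [hQ, ← ENNReal.toReal_one]
    exact ENNReal.toReal_mono hqtop hq1
  have hqQ : q₀ = ENNReal.ofReal Q := (ENNReal.ofReal_toReal hqtop).symm
  refine ⟨Q, hQ1, hqQ, ?_⟩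
  have hs1 : 1 ≤ √Q := Real.one_le_sqrt.2 hQ1
  have hreal : p₀ ≠ ⊤ → 1 / p₀.toReal + 1 / Q = 1 := by
    intro hp
    have h := congrArg ENNReal.toReal hpq
    rw [ENNReal.toReal_add (by simp [(zero_lt_one.trans hp1).ne'])
      (by simp [(zero_lt_one.trans_le hq1).ne'])] at h
    simpa using h
  have hpreal : p₀ ≠ ⊤ → 1 < p₀.toReal := by
    intro hp
    rw [← ENNReal.toReal_one]
    exact (ENNReal.toReal_lt_toReal ENNReal.one_ne_top hp).2 hp1
  rcases hdim with ⟨hN, -⟩ | ⟨hN, -, hp⟩ | ⟨hN, -, hp⟩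
  · have : (N : ℝ) ≤ 9 := by exact_mod_cast hN
    linarith
  · have h1 := hreal hp.ne
    have h2 := hpreal hp.ne
    have h3 : 1 < Q := by
      rcases hQ1.lt_or_eq with h | h
      · exact h
      · rw [← h] at h1
        have : 0 < 1 / p₀.toReal := by positivity
        linarith
    rw [hN]
    push_cast
    linarith
  · have hptop : p₀ ≠ ⊤ := (hp.trans ENNReal.ofReal_lt_top).ne
    have h1 := hreal hptop
    have h2 := hpreal hptop
    have h3 : p₀.toReal < pc N := ENNReal.toReal_lt_of_lt_ofReal hp
    have hN' : (11 : ℝ) ≤ N := by exact_mod_cast hN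
    set P := p₀.toReal
    obtain ⟨s, hs, hsN⟩ : ∃ s : ℝ, 0 ≤ s ∧ s ^ 2 = N - 1 :=
      ⟨√(N - 1), Real.sqrt_nonneg _, Real.sq_sqrt (by linarith)⟩
    have hN2 : (N : ℝ) = s ^ 2 + 1 := by linarith
    have hs3 : 3 < s := by nlinarith
    have hpc : pc N = (s - 1) ^ 2 / ((s - 3) * (s + 1)) := by
      have : √((N : ℝ) - 1) = s := by rw [← hsN, Real.sqrt_sq hs]
      rw [pc, this, hN2, div_eq_div_iff]
      · ring
      · refine mul_ne_zero (by nlinarith) (by nlinarith)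
      · refine mul_ne_zero (by linarith) (by linarith)
    rw [hpc, lt_div_iff₀ (by nlinarith)] at h3
    have h4 : Q + P = P * Q := by
      field_simp at h1
      linarith
    have h5 : ((s - 1) / 2) ^ 2 < Q := by
      by_contra! hle
      nlinarith
    have h6 : (s - 1) / 2 < √Q := Real.lt_sqrt_of_sq_lt h5
    rw [hN2]
    nlinarith

/-- Choice of the exponents used in the test functions. -/
theorem exists_exponents {n Q : ℝ} (hQ : 1 ≤ Q) (hn : n < 2 + 4 * Q + 4 * √Q) :
    ∃ α q₁ q₂ : ℝ, 1 < α ∧ Q < q₁ ∧ 0 < q₂ ∧ q₂ < Q ∧ (α - 1) ^ 2 * q₁ < 1 ∧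
      n < 2 + 2 * (2 * α * q₂) := by
  have hQ0 : 0 < Q := by linarith
  have hs : 0 < √Q := Real.sqrt_pos.2 hQ0
  have hs2 : √Q ^ 2 = Q := Real.sq_sqrt hQ0.le
  have hlim : Tendsto (fun τ : ℝ => 2 + 4 * (τ * Q) + 4 * τ ^ 2 * √Q) (𝓝[<] 1)
      (𝓝 (2 + 4 * (1 * Q) + 4 * 1 ^ 2 * √Q)) :=
    ((by fun_prop : Continuous fun τ : ℝ => 2 + 4 * (τ * Q) + 4 * τ ^ 2 * √Q).tendsto 1).mono_left
      nhdsWithin_le_nhds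
  obtain ⟨τ, hτ, hτ0, hτ1⟩ := ((hlim.eventually (lt_mem_nhds (by linarith : n < _))).and
    (Ioo_mem_nhdsLT (zero_lt_one' ℝ))).exists
  refine ⟨1 + τ / √Q, Q / τ, τ * Q, ?_, ?_, by positivity, ?_, ?_, ?_⟩
  · have : 0 < τ / √Q := by positivity
    linarith
  · rw [lt_div_iff₀ hτ0]
    nlinarith
  · nlinarith
  · have : (1 + τ / √Q - 1) ^ 2 * (Q / τ) = τ := by
      rw [add_sub_cancel_left, div_pow, hs2]
      field_simp
    linarith
  · have : 2 * (2 * (1 + τ / √Q) * (τ * Q)) = 4 * (τ * Q) + 4 * τ ^ 2 * √Q := by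
      have : τ / √Q * Q = τ * √Q := by
        rw [div_mul_eq_mul_div, div_eq_iff hs.ne', mul_assoc, ← sq, hs2]
      linear_combination 4 * τ * this
    linarith

/-- An odd function with an even derivative on `(0, ∞)` that extends continuously to `0`. -/
theorem hasDerivAt_of_odd {F F' : ℝ → ℝ} (hodd : ∀ t, F (-t) = -F t) (heven : ∀ t, F' (-t) = F' t)
    (hF : ContinuousAt F 0) (hF' : ContinuousAt F' 0) (h : ∀ t > 0, HasDerivAt F (F' t) t) (t : ℝ) :
    HasDerivAt F (F' t) t := by
  refine hasDerivAt_of_hasDerivAt_of_ne' (fun y hy => ?_) hF hF' t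
  rcases hy.lt_or_gt with hy | hy
  · have h1 : HasDerivAt F (F' (-y)) (-y) := h (-y) (by linarith)
    have h2 := (h1.comp y (hasDerivAt_neg y)).neg
    simp only [heven, mul_neg, mul_one, neg_neg] at h2
    refine h2.congr_of_eventuallyEq (Eventually.of_forall fun s => ?_)
    simp [hodd]
  · exact h y hy

theorem hasDerivAt_max_sq (x : ℝ) :
    HasDerivAt (fun y : ℝ => max 0 y ^ 2) (2 * max 0 x) x := by
  refine hasDerivAt_of_hasDerivAt_of_ne' (f := fun y : ℝ => max 0 y ^ 2)
    (g := fun y => 2 * max 0 y) (x := 0) (fun y hy => ?_)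
    (by fun_prop) (by fun_prop) x
  rcases hy.lt_or_gt with hy | hy
  · rw [max_eq_left hy.le, mul_zero]
    refine (hasDerivAt_const y (0 : ℝ)).congr_of_eventuallyEq ?_
    filter_upwards [gt_mem_nhds hy] with s hs
    simp [max_eq_left hs.le]
  · rw [max_eq_right hy.le]
    have := hasDerivAt_pow 2 y
    simp only [Nat.cast_ofNat, Nat.add_one_sub_one, pow_one] at this
    refine this.congr_of_eventuallyEq ?_
    filter_upwards [lt_mem_nhds hy] with s hs
    simp [max_eq_right hs.le]

/-- Derivative of `f f'^{-q}`, whose sign compares `f'²/(f f'')` with `q`. -/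
theorem hasDerivAt_mul_rpow_neg {f g : ℝ → ℝ} {h q t : ℝ} (hf : HasDerivAt f (g t) t)
    (hg : HasDerivAt g h t) (hg0 : 0 < g t) :
    HasDerivAt (fun s => f s * g s ^ (-q)) (g t ^ (-q - 1) * (g t ^ 2 - q * (f t * h))) t := by
  refine (hf.mul (hg.rpow_const (p := -q) (Or.inl hg0.ne'))).congr_deriv ?_
  have : g t ^ (-q) = g t ^ (-q - 1) * g t := by
    rw [← Real.rpow_add_one hg0.ne', sub_add_cancel]
  rw [this]
  ring

theorem exists_le_mul_rpow {f g h : ℝ → ℝ} (hf : ∀ t > 0, HasDerivAt f (g t) t)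
    (hg : ∀ t > 0, HasDerivAt g (h t) t) (hf0 : ∀ t > 0, 0 < f t) (hg0 : ∀ t > 0, 0 < g t)
    (hfm : MonotoneOn f (Set.Ioi 0)) (hgm : MonotoneOn g (Set.Ioi 0)) {q δ M : ℝ} (hq : 0 < q)
    (hδ : 0 < δ) (hM : 0 < M) (hqδ : ∀ t ∈ Set.Ioc 0 δ, q * (f t * h t) ≤ g t ^ 2) :
    ∃ C ≥ 0, ∀ t ∈ Set.Ioc 0 M, f t ≤ C * g t ^ q := by
  have hd : ∀ t > 0, HasDerivAt (fun s => f s * g s ^ (-q)) _ t := fun t ht =>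
    hasDerivAt_mul_rpow_neg (hf t ht) (hg t ht) (hg0 t ht)
  have hmono : MonotoneOn (fun s => f s * g s ^ (-q)) (Set.Ioc 0 δ) := by
    refine monotoneOn_of_hasDerivWithinAt_nonneg (convex_Ioc 0 δ)
      (fun t ht => (hd t ht.1).continuousAt.continuousWithinAt)
      (fun t ht => (hd t (interior_subset ht).1).hasDerivWithinAt) fun t ht => ?_
    have ht' := interior_subset ht
    exact mul_nonneg (Real.rpow_nonneg (hg0 t ht'.1).le _) (by linarith [hqδ t ht'])
  have hpos : ∀ t > 0, 0 < g t ^ q := fun t ht => Real.rpow_pos_of_pos (hg0 t ht) _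
  have hneg : ∀ t > 0, g t ^ (-q) = (g t ^ q)⁻¹ := fun t ht => Real.rpow_neg (hg0 t ht).le _
  refine ⟨max (f δ * (g δ ^ q)⁻¹) (f M * (g δ ^ q)⁻¹), le_max_of_le_left ?_, fun t ht => ?_⟩
  · exact mul_nonneg (hf0 δ hδ).le (inv_nonneg.2 (hpos δ hδ).le)
  · rw [← div_le_iff₀ (hpos t ht.1)]
    rcases le_total t δ with h1 | h1
    · refine le_max_of_le_left ?_
      have := hmono ⟨ht.1, h1⟩ ⟨hδ, le_rfl⟩ h1
      simp only [hneg t ht.1, hneg δ hδ] at this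
      rwa [div_eq_mul_inv]
    · refine le_max_of_le_right ?_
      rw [div_eq_mul_inv]
      have h2 : f t ≤ f M := hfm ht.1 (Set.mem_Ioi.2 hM) ht.2
      have h3 : g δ ^ q ≤ g t ^ q :=
        Real.rpow_le_rpow (hg0 δ hδ).le (hgm (Set.mem_Ioi.2 hδ) ht.1 h1) hq.le
      exact mul_le_mul h2 (inv_anti₀ (hpos δ hδ) h3) (inv_nonneg.2 (hpos t ht.1).le)
        (hf0 M hM).le

theorem tendsto_deriv_zero_of_quotient_le {f g h : ℝ → ℝ} (hf : ∀ t > 0, HasDerivAt f (g t) t)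
    (hg : ∀ t > 0, HasDerivAt g (h t) t) (hf0 : ∀ t > 0, 0 < f t) (hg0 : ∀ t > 0, 0 < g t)
    (hlim : Tendsto f (𝓝[>] 0) (𝓝 0)) {q δ : ℝ} (hq : 0 < q)
    (hδ : 0 < δ) (hqδ : ∀ t ∈ Set.Ioc 0 δ, g t ^ 2 ≤ q * (f t * h t)) :
    Tendsto g (𝓝[>] 0) (𝓝 0) := by
  have hd : ∀ t > 0, HasDerivAt (fun s => f s * g s ^ (-q)) _ t := fun t ht =>
    hasDerivAt_mul_rpow_neg (hf t ht) (hg t ht) (hg0 t ht)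
  have hanti : AntitoneOn (fun s => f s * g s ^ (-q)) (Set.Ioc 0 δ) := by
    refine antitoneOn_of_hasDerivWithinAt_nonpos (convex_Ioc 0 δ)
      (fun t ht => (hd t ht.1).continuousAt.continuousWithinAt)
      (fun t ht => (hd t (interior_subset ht).1).hasDerivWithinAt) fun t ht => ?_
    have ht' := interior_subset ht
    exact mul_nonpos_of_nonneg_of_nonpos (Real.rpow_nonneg (hg0 t ht'.1).le _)
      (by linarith [hqδ t ht'])
  set c := f δ * g δ ^ (-q) with hc
  have hcpos : 0 < c := mul_pos (hf0 δ hδ) (Real.rpow_pos_of_pos (hg0 δ hδ) _)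
  have hle : ∀ t ∈ Set.Ioc 0 δ, g t ≤ (f t / c) ^ q⁻¹ := by
    intro t ht
    have h1 := hanti ht ⟨hδ, le_rfl⟩ ht.2
    simp only [Real.rpow_neg (hg0 t ht.1).le, ← hc] at h1
    rw [Real.le_rpow_inv_iff_of_pos (hg0 t ht.1).le (div_nonneg (hf0 t ht.1).le hcpos.le) hq,
      le_div_iff₀ hcpos]
    rw [← div_eq_mul_inv, le_div_iff₀ (Real.rpow_pos_of_pos (hg0 t ht.1) _)] at h1
    linarith
  have hlim2 : Tendsto (fun t => (f t / c) ^ q⁻¹) (𝓝[>] 0) (𝓝 0) := by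
    have := (hlim.div_const c).rpow_const (p := q⁻¹) (Or.inr (by positivity))
    rwa [zero_div, Real.zero_rpow (by positivity)] at this
  refine tendsto_of_tendsto_of_tendsto_of_le_of_le' tendsto_const_nhds hlim2 ?_ ?_
  · filter_upwards [self_mem_nhdsWithin] with t ht
    exact (hg0 t ht).le
  · filter_upwards [Ioc_mem_nhdsGT hδ] with t ht
    exact hle t ht

/-- The key one-dimensional comparison: `ψ ≤ θ f f' k²` with `θ < 1`, where `φ = f k` and
`ψ = ∫ φ'²`. -/
theorem exists_lt_one_le_mul {f g h k r ψ : ℝ → ℝ} {a q δ M : ℝ}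
    (hf : ∀ t > 0, HasDerivAt f (g t) t) (hg : ∀ t > 0, HasDerivAt g (h t) t)
    (hk : ∀ t > 0, HasDerivAt k (a * r t * g t / f t * k t) t)
    (hψ : ∀ t > 0, HasDerivAt ψ ((g t * k t * (1 + a * r t)) ^ 2) t)
    (hfc : Continuous f) (hgc : Continuous g) (hkc : Continuous k) (hψc : Continuous ψ)
    (hf0 : f 0 = 0) (hψ0 : ψ 0 = 0) (hfp : ∀ t > 0, 0 < f t) (hgp : ∀ t > 0, 0 < g t)
    (hhp : ∀ t > 0, 0 ≤ h t) (hkp : ∀ t > 0, 0 < k t) (hr : ∀ t > 0, r t ∈ Set.Icc (0 : ℝ) 1)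
    (hrδ : ∀ t ≥ δ, r t = 0) (ha : 0 < a) (haq : a ^ 2 * q < 1) (hq : 1 ≤ q) (hδ : 0 < δ)
    (hqδ : ∀ t ∈ Set.Ioc 0 δ, g t ^ 2 ≤ q * (f t * h t)) :
    ∃ θ < 1, ∀ t ∈ Set.Ioc 0 M, ψ t ≤ θ * (f t * g t * k t ^ 2) := by
  have hX : ∀ t > 0, HasDerivAt (fun s => f s * g s * k s ^ 2)
      (k t ^ 2 * (g t ^ 2 + f t * h t + 2 * a * r t * g t ^ 2)) t := by
    intro t ht
    refine (((hf t ht).mul (hg t ht)).mul ((hk t ht).pow 2)).congr_deriv ?_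
    have := (hfp t ht).ne'
    field_simp
    simp
    ring
  have hXpos : ∀ t > 0, 0 < f t * g t * k t ^ 2 := fun t ht =>
    mul_pos (mul_pos (hfp t ht) (hgp t ht)) (pow_pos (hkp t ht) 2)
  have hden : 0 < q + 1 + 2 * a * q := by positivity
  obtain ⟨ε, hε0, hε⟩ : ∃ ε > 0, ε * (q + 1 + 2 * a * q) = 1 - a ^ 2 * q :=
    ⟨(1 - a ^ 2 * q) / (q + 1 + 2 * a * q), div_pos (by linarith) hden, by field_simp⟩
  have hsmall : ∀ t ∈ Set.Ioc 0 δ, ψ t ≤ (1 - ε) * (f t * g t * k t ^ 2) := by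
    have hmono : MonotoneOn (fun t => (1 - ε) * (f t * g t * k t ^ 2) - ψ t) (Set.Icc 0 δ) := by
      refine monotoneOn_of_hasDerivWithinAt_nonneg (convex_Icc 0 δ) (by fun_prop)
        (f' := fun t => (1 - ε) * (k t ^ 2 * (g t ^ 2 + f t * h t + 2 * a * r t * g t ^ 2))
          - (g t * k t * (1 + a * r t)) ^ 2) (fun t ht => ?_) fun t ht => ?_
      · rw [interior_Icc] at ht
        exact (((hX t ht.1).const_mul (1 - ε)).sub (hψ t ht.1)).hasDerivWithinAt
      · rw [interior_Icc] at ht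
        have hrt := hr t ht.1
        have hle := hqδ t ⟨ht.1, ht.2.le⟩
        have hfh : 0 ≤ f t * h t := mul_nonneg (hfp t ht.1).le (hhp t ht.1)
        have heq : (1 - ε) * (k t ^ 2 * (g t ^ 2 + f t * h t + 2 * a * r t * g t ^ 2))
          - (g t * k t * (1 + a * r t)) ^ 2 = k t ^ 2 * (f t * h t - a ^ 2 * (r t ^ 2 * g t ^ 2)
            - ε * (g t ^ 2 + f t * h t + 2 * a * (r t * g t ^ 2))) := by ring
        simp only [heq]
        refine mul_nonneg (sq_nonneg _) ?_
        have hg2 := sq_nonneg (g t)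
        have h1 : r t ^ 2 * g t ^ 2 ≤ q * (f t * h t) := by
          have : r t ^ 2 ≤ 1 := pow_le_one₀ hrt.1 hrt.2
          nlinarith
        have h2 : r t * g t ^ 2 ≤ q * (f t * h t) := by nlinarith [hrt.1, hrt.2]
        have h3 : a ^ 2 * (r t ^ 2 * g t ^ 2) ≤ a ^ 2 * (q * (f t * h t)) := by gcongr
        have h4 : ε * (g t ^ 2 + f t * h t + 2 * a * (r t * g t ^ 2))
            ≤ ε * (q * (f t * h t) + f t * h t + 2 * a * (q * (f t * h t))) := by gcongr
        have h5 : ε * (q * (f t * h t) + f t * h t + 2 * a * (q * (f t * h t)))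
            = (1 - a ^ 2 * q) * (f t * h t) := by rw [← hε]; ring
        linarith
    intro t ht
    have := hmono ⟨le_rfl, hδ.le⟩ ⟨ht.1.le, ht.2⟩ ht.1.le
    simp only [hf0, hψ0, zero_mul, mul_zero, sub_zero] at this
    linarith
  have hlarge : ∀ t ≥ δ, ψ t ≤ f t * g t * k t ^ 2 - ε * (f δ * g δ * k δ ^ 2) := by
    have hmono : MonotoneOn (fun t => f t * g t * k t ^ 2 - ψ t) (Set.Ici δ) := by
      refine monotoneOn_of_hasDerivWithinAt_nonneg (convex_Ici δ) (by fun_prop)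
        (f' := fun t => k t ^ 2 * (g t ^ 2 + f t * h t + 2 * a * r t * g t ^ 2)
          - (g t * k t * (1 + a * r t)) ^ 2) (fun t ht => ?_) fun t ht => ?_
      · rw [interior_Ici] at ht
        exact ((hX t (hδ.trans ht)).sub (hψ t (hδ.trans ht))).hasDerivWithinAt
      · rw [interior_Ici] at ht
        have ht0 := hδ.trans ht
        have hfh : 0 ≤ f t * h t := mul_nonneg (hfp t ht0).le (hhp t ht0)
        simp only [hrδ t (le_of_lt ht)]
        nlinarith [mul_nonneg (sq_nonneg (k t)) hfh]
    intro t ht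
    have h1 := hmono Set.self_mem_Ici ht ht
    have h2 := hsmall δ ⟨hδ, le_rfl⟩
    simp only at h1
    linarith
  obtain ⟨B, hB⟩ := (isCompact_Icc (a := 0) (b := M)).exists_bound_of_continuousOn
    (f := fun t => f t * g t * k t ^ 2) (by fun_prop)
  have hXδ := hXpos δ hδ
  have hB' : 0 < max B 1 := lt_max_of_lt_right one_pos
  refine ⟨max (1 - ε) (1 - ε * (f δ * g δ * k δ ^ 2) / max B 1), max_lt (by linarith) ?_, ?_⟩
  · have : 0 < ε * (f δ * g δ * k δ ^ 2) / max B 1 := by positivity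
    linarith
  intro t ht
  have hXt := hXpos t ht.1
  rcases le_total t δ with h1 | h1
  · refine (hsmall t ⟨ht.1, h1⟩).trans ?_
    exact mul_le_mul_of_nonneg_right (le_max_left _ _) hXt.le
  · refine (hlarge t h1).trans ?_
    refine le_trans ?_ (mul_le_mul_of_nonneg_right (le_max_right _ _) hXt.le)
    have h2 : f t * g t * k t ^ 2 ≤ max B 1 :=
      ((le_abs_self _).trans (hB t ⟨ht.1.le, ht.2⟩)).trans (le_max_left _ _)
    have h3 : ε * (f δ * g δ * k δ ^ 2) / max B 1 * (f t * g t * k t ^ 2)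
        ≤ ε * (f δ * g δ * k δ ^ 2) := by
      rw [div_mul_eq_mul_div, div_le_iff₀ hB']
      gcongr
    linarith

/-- Derivative of the truncated power `k = (1 - (1 - f/s)₊²)^a`. -/
theorem hasDerivAt_truncated_rpow {f : ℝ → ℝ} {g a s t : ℝ} (hf : HasDerivAt f g t) (hs : 0 < s)
    (hft : 0 < f t) :
    HasDerivAt (fun y => (1 - max 0 (1 - f y / s) ^ 2) ^ a)
      (a * (2 * max 0 (1 - f t / s) / (1 + max 0 (1 - f t / s))) * g / f t
        * (1 - max 0 (1 - f t / s) ^ 2) ^ a) t := by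
  have hfs : 0 < f t / s := div_pos hft hs
  have hz0 : 0 ≤ max 0 (1 - f t / s) := le_max_left _ _
  have hz1 : max 0 (1 - f t / s) < 1 := max_lt one_pos (by linarith)
  have hbase : 0 < 1 - max 0 (1 - f t / s) ^ 2 := by nlinarith
  have h1 : HasDerivAt (fun y => 1 - f y / s) (-(g / s)) t := (hf.div_const s).const_sub 1
  have h2 : HasDerivAt (fun y => max 0 (1 - f y / s) ^ 2)
      (2 * max 0 (1 - f t / s) * -(g / s)) t :=
    HasDerivAt.comp (h₂ := fun y : ℝ => max 0 y ^ 2) t (hasDerivAt_max_sq (1 - f t / s)) h1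
  refine ((h2.const_sub 1).rpow_const (p := a) (Or.inl hbase.ne')).congr_deriv ?_
  have h3 : (1 - max 0 (1 - f t / s) ^ 2) ^ a = (1 - max 0 (1 - f t / s) ^ 2) ^ (a - 1)
      * (1 - max 0 (1 - f t / s) ^ 2) := by
    rw [← Real.rpow_add_one hbase.ne', sub_add_cancel]
  rw [h3]
  generalize (1 - max 0 (1 - f t / s) ^ 2) ^ (a - 1) = X
  rcases le_total (1 - f t / s) 0 with h4 | h4
  · rw [max_eq_left h4]
    simp
  · rw [max_eq_right h4]
    have h5 : 1 + (1 - f t / s) ≠ 0 := by linarith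
    have h6 : 1 - (1 - f t / s) ^ 2 = f t / s * (1 + (1 - f t / s)) := by ring
    rw [h6]
    generalize 1 + (1 - f t / s) = Y at *
    field_simp

/-- Elementary properties of a convex, positive, `C²` function on `(0, ∞)` vanishing at `0`. -/
theorem deriv_pos_of_convexOn {f : ℝ → ℝ} (hcont : Continuous f)
    (hC2 : ContDiffOn ℝ 2 f (Set.Ioi 0)) (hconv : ConvexOn ℝ (Set.Ioi 0) f) (hf0 : f 0 = 0)
    (hpos : ∀ t > 0, 0 < f t) :
    (∀ t > 0, HasDerivAt f (deriv f t) t) ∧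
      (∀ t > 0, HasDerivAt (deriv f) (deriv (deriv f) t) t) ∧
      MonotoneOn (deriv f) (Set.Ioi 0) ∧ (∀ t > 0, 0 < deriv f t) ∧
      ∀ t > 0, 0 ≤ deriv (deriv f) t := by
  have hd1 : ∀ t > 0, HasDerivAt f (deriv f t) t := fun t ht =>
    ((hC2.differentiableOn (by norm_num) t ht).differentiableAt (Ioi_mem_nhds ht)).hasDerivAt
  have hC1 : ContDiffOn ℝ 1 (deriv f) (Set.Ioi 0) :=
    hC2.deriv_of_isOpen isOpen_Ioi (by norm_num)
  have hd2 : ∀ t > 0, HasDerivAt (deriv f) (deriv (deriv f) t) t := fun t ht =>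
    ((hC1.differentiableOn (by norm_num) t ht).differentiableAt (Ioi_mem_nhds ht)).hasDerivAt
  have hm : MonotoneOn (deriv f) (Set.Ioi 0) :=
    hconv.monotoneOn_deriv fun t ht => (hd1 t ht).differentiableAt
  refine ⟨hd1, hd2, hm, fun t ht => ?_, fun t ht => ?_⟩
  · obtain ⟨ξ, hξ, h⟩ := exists_hasDerivAt_eq_slope f (deriv f) ht hcont.continuousOn
      fun x hx => hd1 x hx.1
    rw [hf0, sub_zero, sub_zero] at h
    exact (h ▸ div_pos (hpos t ht) ht).trans_le (hm hξ.1 ht hξ.2.le)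
  · rw [← derivWithin_of_isOpen isOpen_Ioi ht]
    exact hm.derivWithin_nonneg

/-- An odd function which is `C¹` on `(0, ∞)` with a derivative vanishing at `0` is `C¹`. -/
theorem continuous_deriv_of_odd {f : ℝ → ℝ} (hcont : Continuous f) (hodd : ∀ t, f (-t) = -f t)
    (hd : ∀ t > 0, HasDerivAt f (deriv f t) t) (hd' : ∀ t > 0, ContinuousAt (deriv f) t)
    (hlim : Tendsto (deriv f) (𝓝[>] 0) (𝓝 0)) :
    (∀ t, HasDerivAt f (deriv f t) t) ∧ Continuous (deriv f) ∧ ∀ t, deriv f (-t) = deriv f t := by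
  set G : ℝ → ℝ := fun t => if t = 0 then 0 else deriv f |t| with hG
  have hG1 : ∀ t > 0, G t = deriv f t := fun t ht => by simp [hG, ht.ne', abs_of_pos ht]
  have heven : ∀ t, G (-t) = G t := fun t => by simp [hG]
  have hG0 : ContinuousAt G 0 := by
    rw [continuousAt_iff_punctured_nhds]
    have h1 : Tendsto (fun t : ℝ => |t|) (𝓝[≠] 0) (𝓝[>] 0) := tendsto_abs_nhdsNE_zero
    have h2 := hlim.comp h1
    have : G 0 = 0 := by simp [hG]
    rw [this]
    refine h2.congr' ?_
    filter_upwards [self_mem_nhdsWithin] with t ht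
    have : t ≠ 0 := ht
    simp [hG, this]
  have hder := hasDerivAt_of_odd hodd heven hcont.continuousAt hG0 fun t ht => by
    rw [hG1 t ht]; exact hd t ht
  have hGeq : deriv f = G := funext fun t => (hder t).deriv
  have hGc : ∀ t > 0, ContinuousAt G t := fun t ht => hGeq ▸ hd' t ht
  rw [hGeq]
  refine ⟨hder, continuous_iff_continuousAt.2 fun t => ?_, heven⟩
  rcases lt_trichotomy t 0 with ht | rfl | ht
  · have h1 : ContinuousAt (fun s => G (-s)) t :=
      ContinuousAt.comp (f := fun s : ℝ => -s) (hGc (-t) (by linarith)) continuous_neg.continuousAt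
    simpa only [heven] using h1
  · exact hG0
  · exact hGc t ht

/-- The test function `φ`, which behaves like `|f|^α` near `0` and like `f` away from `0`. -/
theorem exists_test_function {f g h : ℝ → ℝ} {α q δ M : ℝ}
    (hf : ∀ t, HasDerivAt f (g t) t) (hg : ∀ t > 0, HasDerivAt g (h t) t)
    (hgc : Continuous g) (hodd : ∀ t, f (-t) = -f t) (heven : ∀ t, g (-t) = g t)
    (hmono : Monotone f) (hfp : ∀ t > 0, 0 < f t) (hgp : ∀ t > 0, 0 < g t)
    (hhp : ∀ t > 0, 0 ≤ h t) (hα : 1 < α) (hαq : (α - 1) ^ 2 * q < 1) (hq : 1 ≤ q) (hδ : 0 < δ)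
    (hqδ : ∀ t ∈ Set.Ioc 0 δ, g t ^ 2 ≤ q * (f t * h t)) :
    ∃ φ φ' ψ : ℝ → ℝ, ∃ θ K : ℝ, Continuous φ' ∧ (∀ t, HasDerivAt φ (φ' t) t) ∧
      (∀ t, HasDerivAt ψ (φ' t ^ 2) t) ∧ θ < 1 ∧
      (∀ t, |t| ≤ M → f t * ψ t ≤ θ * (g t * φ t ^ 2)) ∧
      (∀ t, |t| ≤ M → |ψ t| ≤ |φ t * φ' t|) ∧ (∀ t > 0, 0 < φ t) ∧
      (∀ t, φ (-t) = -φ t) ∧ 0 ≤ K ∧ ∀ t > 0, φ t ≤ K * f t ^ α := by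
  have hfc : Continuous f := continuous_iff_continuousAt.2 fun t => (hf t).continuousAt
  have hf0 : f 0 = 0 := by
    have := hodd 0
    rw [neg_zero] at this
    linarith
  have ha : 0 < α - 1 := by linarith
  have hs : 0 < f δ := hfp δ hδ
  set z : ℝ → ℝ := fun t => max 0 (1 - |f t| / f δ) with hz
  set k : ℝ → ℝ := fun t => (1 - z t ^ 2) ^ (α - 1) with hk
  set r : ℝ → ℝ := fun t => 2 * z t / (1 + z t) with hr
  have hz0 : ∀ t, 0 ≤ z t := fun t => le_max_left _ _
  have hz1 : ∀ t > 0, z t < 1 := fun t ht => max_lt one_pos (by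
    have : 0 < |f t| / f δ := div_pos (abs_pos.2 (hfp t ht).ne') hs
    linarith)
  have hzpos : ∀ t > 0, z t = max 0 (1 - f t / f δ) := fun t ht => by
    simp only [hz, abs_of_pos (hfp t ht)]
  have hbase : ∀ t > 0, 0 < 1 - z t ^ 2 := fun t ht => by nlinarith [hz0 t, hz1 t ht]
  have hkp : ∀ t > 0, 0 < k t := fun t ht => Real.rpow_pos_of_pos (hbase t ht) _
  have hzeven : ∀ t, z (-t) = z t := fun t => by simp [hz, hodd]
  have hzc : Continuous z := by fun_prop
  have hkc : Continuous k := Continuous.rpow_const (by fun_prop) fun _ => Or.inr ha.le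
  have hrc : Continuous r := by
    refine Continuous.div (by fun_prop) (by fun_prop) fun t => ?_
    have := hz0 t
    positivity
  have hr01 : ∀ t > 0, r t ∈ Set.Icc (0 : ℝ) 1 := fun t ht => by
    have h0 := hz0 t
    have h1 := hz1 t ht
    refine ⟨by positivity, ?_⟩
    simp only [hr]
    rw [div_le_one (by positivity)]
    linarith
  have hrδ : ∀ t ≥ δ, r t = 0 := fun t ht => by
    have h1 : z t = 0 := by
      rw [hzpos t (hδ.trans_le ht)]
      refine max_eq_left ?_
      rw [sub_nonpos, one_le_div hs]
      exact hmono ht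
    simp [hr, h1]
  have hkd : ∀ t > 0, HasDerivAt k ((α - 1) * r t * g t / f t * k t) t := fun t ht => by
    have h1 := hasDerivAt_truncated_rpow (a := α - 1) (hf t) hs (hfp t ht)
    rw [← hzpos t ht] at h1
    refine h1.congr_of_eventuallyEq ?_
    filter_upwards [lt_mem_nhds ht] with y hy
    simp only [hk, hzpos y hy]
  set φ' : ℝ → ℝ := fun t => g t * k t * (1 + (α - 1) * r t) with hφ'
  have hφ'c : Continuous φ' := by fun_prop
  have hφ'even : ∀ t, φ' (-t) = φ' t := fun t => by simp only [hφ', hk, hr, hzeven, heven]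
  have hφodd : ∀ t, f (-t) * k (-t) = -(f t * k t) := fun t => by
    simp only [hk, hzeven, hodd, neg_mul]
  have hφd : ∀ t, HasDerivAt (fun t => f t * k t) (φ' t) t :=
    hasDerivAt_of_odd hφodd hφ'even (hfc.mul hkc).continuousAt hφ'c.continuousAt fun t ht => by
      refine ((hf t).mul (hkd t ht)).congr_deriv ?_
      have := (hfp t ht).ne'
      simp only [hφ']
      field_simp
  set ψ : ℝ → ℝ := fun t => ∫ s in (0 : ℝ)..t, φ' s ^ 2 with hψ
  have hψd : ∀ t, HasDerivAt ψ (φ' t ^ 2) t := fun t =>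
    (hφ'c.pow 2).integral_hasStrictDerivAt 0 t |>.hasDerivAt
  have hψ0 : ψ 0 = 0 := by simp [hψ]
  have hψodd : ∀ t, ψ (-t) = -ψ t := fun t => by
    have h1 := intervalIntegral.integral_comp_neg (a := 0) (b := t) fun s => φ' s ^ 2
    simp only [hφ'even, neg_zero] at h1
    simp only [hψ]
    rw [h1, intervalIntegral.integral_symm]
  have hψ_nonneg : ∀ t > 0, 0 ≤ ψ t := fun t ht =>
    intervalIntegral.integral_nonneg ht.le fun s _ => sq_nonneg _
  obtain ⟨θ, hθ, hθψ⟩ := exists_lt_one_le_mul (M := M) (fun t _ => hf t) hg hkd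
    (fun t _ => hψd t) hfc hgc hkc
    (continuous_iff_continuousAt.2 fun t => (hψd t).continuousAt) hf0 hψ0 hfp hgp hhp hkp hr01
    hrδ ha hαq hq hδ hqδ
  have key : ∀ t ∈ Set.Ioc 0 M, f t * ψ t ≤ θ * (g t * (f t * k t) ^ 2) ∧
      |ψ t| ≤ |f t * k t * φ' t| := fun t ht => by
    have h1 := hθψ t ht
    have hft := hfp t ht.1
    refine ⟨?_, ?_⟩
    · calc f t * ψ t ≤ f t * (θ * (f t * g t * k t ^ 2)) := by gcongr
        _ = _ := by ring
    · rw [abs_of_nonneg (hψ_nonneg t ht.1)]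
      have h2 : 0 < f t * g t * k t ^ 2 :=
        mul_pos (mul_pos hft (hgp t ht.1)) (pow_pos (hkp t ht.1) 2)
      have h3 : f t * k t * φ' t = f t * g t * k t ^ 2 * (1 + (α - 1) * r t) := by
        simp only [hφ']
        ring
      have h4 : 0 ≤ (α - 1) * r t := mul_nonneg ha.le (hr01 t ht.1).1
      refine le_trans ?_ (le_abs_self _)
      rw [h3]
      nlinarith
  have key0 : ∀ t, t = 0 → f t * ψ t ≤ θ * (g t * (f t * k t) ^ 2) ∧
      |ψ t| ≤ |f t * k t * φ' t| := by
    rintro t rfl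
    simp [hf0, hψ0]
  have key' : ∀ t, |t| ≤ M → f t * ψ t ≤ θ * (g t * (f t * k t) ^ 2) ∧
      |ψ t| ≤ |f t * k t * φ' t| := fun t ht => by
    rcases lt_trichotomy t 0 with h1 | h1 | h1
    · have h2 := key (-t) ⟨by linarith, by rwa [abs_of_neg h1] at ht⟩
      rw [hψodd, hφodd, hφ'even, heven, hodd, neg_mul_neg, neg_sq, abs_neg, neg_mul, abs_neg]
        at h2
      exact h2
    · exact key0 t h1
    · exact key t ⟨h1, by rwa [abs_of_pos h1] at ht⟩
  refine ⟨fun t => f t * k t, φ', ψ, θ, (2 / f δ) ^ (α - 1), hφ'c, hφd, hψd, hθ,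
    fun t ht => (key' t ht).1, fun t ht => (key' t ht).2,
    fun t ht => mul_pos (hfp t ht) (hkp t ht), hφodd, by positivity, fun t ht => ?_⟩
  have hft := hfp t ht
  have h1 : 1 - z t ^ 2 ≤ 2 / f δ * f t := by
    have h2 : 1 - f t / f δ ≤ z t := hzpos t ht ▸ le_max_right _ _
    have h3 : 2 / f δ * f t = 2 * (f t / f δ) := by ring
    nlinarith [hz0 t, hz1 t ht]
  have h2 : k t ≤ (2 / f δ) ^ (α - 1) * f t ^ (α - 1) := by
    rw [← Real.mul_rpow (by positivity) hft.le]
    exact Real.rpow_le_rpow (hbase t ht).le h1 ha.le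
  calc f t * k t ≤ f t * ((2 / f δ) ^ (α - 1) * f t ^ (α - 1)) := by gcongr
    _ = (2 / f δ) ^ (α - 1) * (f t ^ (α - 1) * f t) := by ring
    _ = _ := by rw [← Real.rpow_add_one hft.ne', sub_add_cancel]

/-- Two-sided bounds on `f'²` by `f f''` near `0` in terms of the limit of `qfun`. -/
theorem exists_bounds_of_tendsto_qfun {f : ℝ → ℝ} {Q q₁ q₂ : ℝ}
    (hq : Tendsto (qfun f) (𝓝[>] (0 : ℝ)) (𝓝 (ENNReal.ofReal Q))) (hq₁ : Q < q₁) (hq₂ : q₂ < Q)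
    (hQ : 0 < Q) (hfh : ∀ t > 0, 0 ≤ f t * deriv (deriv f) t) :
    ∃ δ > 0, ∀ t ∈ Set.Ioc 0 δ, q₂ * (f t * deriv (deriv f) t) ≤ deriv f t ^ 2 ∧
      deriv f t ^ 2 ≤ q₁ * (f t * deriv (deriv f) t) := by
  have h1 := hq.eventually (gt_mem_nhds ((ENNReal.ofReal_lt_ofReal_iff (hQ.trans hq₁)).2 hq₁))
  have h2 := hq.eventually (lt_mem_nhds ((ENNReal.ofReal_lt_ofReal_iff hQ).2 hq₂))
  obtain ⟨δ, hδ, h⟩ := mem_nhdsGT_iff_exists_Ioc_subset.1 (h1.and h2)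
  refine ⟨δ, hδ, fun t ht => ?_⟩
  obtain ⟨h3, h4⟩ := h ht
  have h0 : f t * deriv (deriv f) t ≠ 0 := fun h0 => by simp [qfun, h0] at h3
  have hp : 0 < f t * deriv (deriv f) t := (hfh t ht.1).lt_of_ne' h0
  rw [qfun, if_neg h0] at h3 h4
  have h5 := (ENNReal.ofReal_lt_ofReal_iff (hQ.trans hq₁)).1 h3
  have h6 := (ENNReal.ofReal_lt_ofReal_iff'.1 h4).1
  rw [div_lt_iff₀ hp] at h5
  rw [lt_div_iff₀ hp] at h6
  exact ⟨h6.le, h5.le⟩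

/-- Corollary 1.8: Liouville theorem for bounded sign-changing stable solutions
when `f` is odd, nondecreasing, and convex positive on `(0,∞)`. -/
theorem stmt4 {N : ℕ} (hN : 1 ≤ N) (f : ℝ → ℝ)
    (hcont : Continuous f) (hC2 : ContDiffOn ℝ 2 f (Set.Ioi 0))
    (hmono : Monotone f) (hodd : ∀ t : ℝ, f (-t) = -f t)
    (hconv : ConvexOn ℝ (Set.Ioi 0) f)
    (hpos : ∀ t : ℝ, 0 < t → 0 < f t)
    (q₀ p₀ : ℝ≥0∞) (hq : Tendsto (qfun f) (𝓝[>] (0:ℝ)) (𝓝 q₀))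
    (hpq : 1 / p₀ + 1 / q₀ = 1)
    (u : EuclideanSpace ℝ (Fin N) → ℝ) (hu : ContDiff ℝ 2 u)
    (hbd : ∃ M, ∀ x, |u x| ≤ M)
    (hsol : ∀ x, -lap u x = f (u x)) (hstab : Stable (deriv f) u)
    (hdim : (N ≤ 9 ∧ 1 < p₀) ∨
      (N = 10 ∧ 1 < p₀ ∧ p₀ < ⊤) ∨
      (11 ≤ N ∧ 1 < p₀ ∧ p₀ < ENNReal.ofReal (pc N))) :
    ∀ x, u x = 0 := by
  obtain ⟨Q, hQ, rfl, hNQ⟩ := exists_toReal_of_dim hpq hdim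
  obtain ⟨α, q₁, q₂, hα, hq₁, hq₂0, hq₂, hαq, hNα⟩ := exists_exponents hQ hNQ
  have hf0 : f 0 = 0 := by
    have := hodd 0
    rw [neg_zero] at this
    linarith
  obtain ⟨hd1, hd2, hgm, hgp, hhp⟩ := deriv_pos_of_convexOn hcont hC2 hconv hf0 hpos
  obtain ⟨δ, hδ, hqδ⟩ := exists_bounds_of_tendsto_qfun hq hq₁ hq₂ (by linarith) fun t ht =>
    mul_nonneg (hpos t ht).le (hhp t ht)
  have hlim : Tendsto f (𝓝[>] 0) (𝓝 0) := by
    have := (hcont.tendsto 0).mono_left (nhdsWithin_le_nhds (s := Set.Ioi 0))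
    rwa [hf0] at this
  obtain ⟨hd, hgc, heven⟩ := continuous_deriv_of_odd hcont hodd hd1
    (fun t ht => (hd2 t ht).continuousAt)
    (tendsto_deriv_zero_of_quotient_le hd1 hd2 hpos hgp hlim (by linarith) hδ
      fun t ht => (hqδ t ht).2)
  obtain ⟨M₀, hM₀⟩ := hbd
  obtain ⟨M, hM0, hM⟩ : ∃ M > 0, ∀ x, |u x| ≤ M :=
    ⟨max M₀ 1, by positivity, fun x => (hM₀ x).trans (le_max_left _ _)⟩
  obtain ⟨φ, φ', ψ, θ, K, hφ'c, hφ, hψ, hθ, hfψ, hψφ, hφp, hφodd, hK, hφα⟩ :=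
    exists_test_function (M := M) hd hd2 hgc hodd heven hmono hpos hgp hhp hα hαq
      (hQ.trans hq₁.le) hδ fun t ht => (hqδ t ht).2
  obtain ⟨C₁, hC₁, hfg⟩ := exists_le_mul_rpow hd1 hd2 hpos hgp (hmono.monotoneOn _) hgm hq₂0 hδ
    hM0 fun t ht => (hqδ t ht).1
  have hφ0 : φ 0 = 0 := by
    have := hφodd 0
    rw [neg_zero] at this
    linarith
  have hg0 : 0 ≤ deriv f 0 := hmono.deriv_nonneg
  have hbound : ∀ t ∈ Set.Ioc 0 M,
      φ t ^ 2 ≤ (K * C₁ ^ α) ^ 2 * deriv f t ^ (2 * α * q₂) := by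
    intro t ht
    have hgt := hgp t ht.1
    have h1 : φ t ≤ K * C₁ ^ α * deriv f t ^ (α * q₂) := by
      calc φ t ≤ K * f t ^ α := hφα t ht.1
        _ ≤ K * (C₁ * deriv f t ^ q₂) ^ α := by
          gcongr
          exacts [(hpos t ht.1).le, hfg t ht]
        _ = _ := by
          rw [Real.mul_rpow hC₁ (by positivity), ← Real.rpow_mul hgt.le, mul_comm q₂, mul_assoc]
    have h2 : deriv f t ^ (2 * α * q₂) = (deriv f t ^ (α * q₂)) ^ 2 := by
      rw [← Real.rpow_natCast, ← Real.rpow_mul hgt.le]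
      congr 1
      push_cast
      ring
    rw [h2, ← mul_pow]
    exact pow_le_pow_left₀ (hφp t ht.1).le h1 2
  have hbound' : ∀ t, |t| ≤ M → φ t ^ 2 ≤ (K * C₁ ^ α) ^ 2 * deriv f t ^ (2 * α * q₂) := by
    intro t ht
    rcases lt_trichotomy t 0 with h1 | rfl | h1
    · have := hbound (-t) ⟨by linarith, by rwa [abs_of_neg h1] at ht⟩
      rwa [hφodd, heven, neg_sq] at this
    · rw [hφ0, zero_pow two_ne_zero]
      positivity
    · exact hbound t ⟨h1, by rwa [abs_of_pos h1] at ht⟩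
  have hφc : Continuous φ := continuous_iff_continuousAt.2 fun t => (hφ t).continuousAt
  obtain ⟨c, hc, C, hC, hcac⟩ := hstab.exists_integral_le hcont hgc hu hsol hφ'c hφ hψ hθ
    (fun x => hfψ _ (hM x)) fun x => hψφ _ (hM x)
  intro x
  have hzero := mul_eq_zero_of_caccioppoli (w := fun x => deriv f (u x))
    (p := fun x => φ (u x) ^ 2) (β := 2 * α * q₂) (hgc.comp hu.continuous)
    ((hφc.comp hu.continuous).pow 2) (fun x => hmono.deriv_nonneg) (fun x => sq_nonneg _)
    (by positivity) (by positivity) (fun x => hbound' _ (hM x)) hNα hc hC hcac x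
  by_contra hne
  have hpos' : 0 < deriv f (u x) ∧ φ (u x) ≠ 0 := by
    rcases lt_or_gt_of_ne hne with h1 | h1
    · have h2 := hgp (-u x) (by linarith)
      have h3 := hφp (-u x) (by linarith)
      rw [heven] at h2
      rw [hφodd] at h3
      exact ⟨h2, by linarith⟩
    · exact ⟨hgp _ h1, (hφp _ h1).ne'⟩
  exact mul_ne_zero hpos'.1.ne' (pow_ne_zero 2 hpos'.2) hzero
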